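/- Let q be a real number with q ≥ 1 and let (B_n(x,q))_{n≥0} be the type B q-Eulerian polynomials, defined by B_0(x,q) = 1 and B_{n+1}(x,q) = ((1+q) n x + q x + 1) B_n(x,q) + (1+q) x (1 − x) ∂_x B_n(x,q) for n ≥ 0, so that deg_x B_n(x,q) = n. Then for every n ≥ 1, B_n(x,q) is bi-gamma-positive and the reciprocal polynomial x^n B_n(1/x, q) is ratio monotone. -/

import Mathlib

open Polynomial

/-- A real polynomial `p` (with symmetric coefficients) is gamma-positive if
`p = ∑ γ k * X^k * (1+X)^(deg p - 2k)` with all `γ k ≥ 0`. -/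
def GammaPositive (p : Polynomial ℝ) : Prop :=
  ∃ γ : ℕ → ℝ, (∀ k, 0 ≤ γ k) ∧
    p = ∑ k ∈ Finset.range (p.natDegree / 2 + 1),
      Polynomial.C (γ k) * Polynomial.X ^ k * (1 + Polynomial.X) ^ (p.natDegree - 2 * k)

/-- A real polynomial `f` of degree `n` is bi-gamma-positive if both parts of its
symmetric decomposition `f = a + X * b`, where
`a = (f - X^(n+1) f(1/X))/(1 - X)` and `b = (X^n f(1/X) - f)/(1 - X)`,
are gamma-positive.  (Here `X^n f(1/X)` is `Polynomial.reflect n f`.) -/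
def BiGammaPositive (f : Polynomial ℝ) : Prop :=
  ∃ a b : Polynomial ℝ,
    (1 - Polynomial.X) * a = f - Polynomial.X * Polynomial.reflect f.natDegree f ∧
    (1 - Polynomial.X) * b = Polynomial.reflect f.natDegree f - f ∧
    GammaPositive a ∧ GammaPositive b

/-- A real polynomial `p = a_0 + a_1 X + ⋯ + a_n X^n` of degree `n` with positive
coefficients is ratio monotone if
`a_n/a_0 ≤ a_(n-1)/a_1 ≤ ⋯ ≤ a_(n-⌊(n-1)/2⌋)/a_(⌊(n-1)/2⌋) ≤ 1` and
`a_0/a_(n-1) ≤ a_1/a_(n-2) ≤ ⋯ ≤ a_(⌊n/2⌋-1)/a_(n-⌊n/2⌋) ≤ 1`. -/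
def RatioMonotone (p : Polynomial ℝ) : Prop :=
  (∀ i ≤ p.natDegree, 0 < p.coeff i) ∧
  (∀ i : ℕ, i + 1 ≤ (p.natDegree - 1) / 2 →
    p.coeff (p.natDegree - i) / p.coeff i ≤
      p.coeff (p.natDegree - (i + 1)) / p.coeff (i + 1)) ∧
  (p.coeff (p.natDegree - (p.natDegree - 1) / 2) / p.coeff ((p.natDegree - 1) / 2) ≤ 1) ∧
  (∀ i : ℕ, i + 2 ≤ p.natDegree / 2 →
    p.coeff i / p.coeff (p.natDegree - 1 - i) ≤
      p.coeff (i + 1) / p.coeff (p.natDegree - 1 - (i + 1))) ∧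
  (1 ≤ p.natDegree / 2 →
    p.coeff (p.natDegree / 2 - 1) / p.coeff (p.natDegree - p.natDegree / 2) ≤ 1)

/-- The cone generated by the polynomials `X ^ k * (1 + X) ^ e` with `2 * k + e = d`. -/
inductive GammaCone (d : ℕ) : ℝ[X] → Prop
  | zero : GammaCone d 0
  | add {p r : ℝ[X]} : GammaCone d p → GammaCone d r → GammaCone d (p + r)
  | basis (k e : ℕ) (c : ℝ) : 2 * k + e = d → 0 ≤ c →
      GammaCone d (C c * X ^ k * (1 + X) ^ e)

namespace GammaCone

theorem C_mul {d : ℕ} {p : ℝ[X]} (hp : GammaCone d p) {s : ℝ} (hs : 0 ≤ s) :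
    GammaCone d (C s * p) := by
  induction hp with
  | zero => simpa using zero
  | add _ _ h₁ h₂ => rw [mul_add]; exact add h₁ h₂
  | basis k e c h hc =>
    convert basis k e (s * c) h (mul_nonneg hs hc) using 1
    simp only [map_mul]; ring

theorem one_add_X_mul {d : ℕ} {p : ℝ[X]} (hp : GammaCone d p) :
    GammaCone (d + 1) ((1 + X) * p) := by
  induction hp with
  | zero => simpa using zero
  | add _ _ h₁ h₂ => rw [mul_add]; exact add h₁ h₂
  | basis k e c h hc =>
    convert basis (d := d + 1) k (e + 1) c (by omega) hc using 1
    ring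

theorem X_mul {d : ℕ} {p : ℝ[X]} (hp : GammaCone d p) : GammaCone (d + 2) (X * p) := by
  induction hp with
  | zero => simpa using zero
  | add _ _ h₁ h₂ => rw [mul_add]; exact add h₁ h₂
  | basis k e c h hc =>
    convert basis (d := d + 2) (k + 1) e c (by omega) hc using 1
    ring

theorem eulerian_operator {d : ℕ} {p : ℝ[X]} (hp : GammaCone d p) :
    GammaCone (d + 1) (C (d : ℝ) * X * p + X * (1 - X) * derivative p) := by
  induction hp with
  | zero => simpa using zero
  | add _ _ h₁ h₂ =>
    convert add h₁ h₂ using 1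
    rw [derivative_add]; ring
  | basis k e c h hc =>
    subst h
    have hk : (X : ℝ[X]) * derivative (X ^ k) = C (k : ℝ) * X ^ k := by
      cases k with
      | zero => simp
      | succ k => simp only [derivative_X_pow, Nat.add_sub_cancel]; ring
    have h₁ := basis (d := 2 * k + e + 1) k (e + 1) (k * c) (by omega) (by positivity)
    cases e with
    | zero =>
      convert h₁ using 1
      simp only [derivative_mul, derivative_C, pow_zero, derivative_one, Nat.cast_add,
        Nat.cast_mul, Nat.cast_ofNat, map_add, map_mul, map_ofNat, map_zero, Nat.cast_zero]
      linear_combination (C c * (1 - X)) * hk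
    | succ e =>
      have h₂ := basis (d := 2 * k + (e + 1) + 1) (k + 1) e (2 * (e + 1) * c) (by omega)
        (by positivity)
      convert add h₁ h₂ using 1
      simp only [derivative_mul, derivative_C, derivative_pow, derivative_one,
        derivative_X, Nat.cast_add, Nat.cast_mul, Nat.cast_ofNat, map_add, map_mul, map_ofNat,
        map_one, Nat.cast_one, Nat.add_sub_cancel] at hk ⊢
      linear_combination (C c * (1 - X) * (1 + X) ^ (e + 1)) * hk

theorem natDegree_le {d : ℕ} {p : ℝ[X]} (hp : GammaCone d p) : p.natDegree ≤ d := by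
  induction hp with
  | zero => simp
  | add _ _ h₁ h₂ => exact natDegree_add_le_of_degree_le h₁ h₂
  | basis k e c h hc =>
    have h₁ : ((C c * X ^ k : ℝ[X])).natDegree ≤ k := natDegree_C_mul_X_pow_le c k
    have h₂ : ((1 + X : ℝ[X]) ^ e).natDegree ≤ e := by compute_degree
    exact natDegree_mul_le.trans (by omega)

theorem _root_.Polynomial.reflect_one_add_X_pow (e : ℕ) :
    reflect e ((1 + X : ℝ[X]) ^ e) = (1 + X) ^ e := by
  ext i
  rw [coeff_reflect, coeff_one_add_X_pow, coeff_one_add_X_pow]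
  rcases le_or_gt i e with h | h
  · rw [revAt_le h, Nat.choose_symm h]
  · rw [revAt_eq_self_of_lt h]

theorem reflect_eq {d : ℕ} {p : ℝ[X]} (hp : GammaCone d p) : reflect d p = p := by
  induction hp with
  | zero => simp
  | add _ _ h₁ h₂ => rw [reflect_add, h₁, h₂]
  | basis k e c h hc =>
    have h₁ : ((C c * X ^ k : ℝ[X])).natDegree ≤ 2 * k :=
      (natDegree_C_mul_X_pow_le c k).trans (by omega)
    have h₂ : ((1 + X : ℝ[X]) ^ e).natDegree ≤ e := by compute_degree
    rw [← h, reflect_mul _ _ h₁ h₂, reflect_one_add_X_pow, reflect_C_mul_X_pow,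
      revAt_le (by omega)]
    congr 3
    omega

theorem exists_coeff {d : ℕ} {p : ℝ[X]} (hp : GammaCone d p) :
    ∃ γ : ℕ → ℝ, (∀ k, 0 ≤ γ k) ∧
      p = ∑ k ∈ Finset.range (d / 2 + 1), C (γ k) * X ^ k * (1 + X) ^ (d - 2 * k) := by
  induction hp with
  | zero => exact ⟨0, by simp, by simp⟩
  | add _ _ h₁ h₂ =>
    obtain ⟨γ, hγ, h₁⟩ := h₁
    obtain ⟨δ, hδ, h₂⟩ := h₂
    refine ⟨γ + δ, fun k => add_nonneg (hγ k) (hδ k), ?_⟩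
    rw [h₁, h₂, ← Finset.sum_add_distrib]
    refine Finset.sum_congr rfl fun k _ => ?_
    simp only [Pi.add_apply, map_add]; ring
  | basis k e c h hc =>
    refine ⟨Pi.single k c, fun j => ?_, ?_⟩
    · rw [Pi.single_apply]; split_ifs <;> simp [hc]
    · rw [Finset.sum_eq_single_of_mem k (Finset.mem_range.2 (by omega))]
      · rw [Pi.single_eq_same, show d - 2 * k = e by omega]
      · intro j _ hj
        simp [Pi.single_eq_of_ne hj]

theorem gammaPositive {d : ℕ} {p : ℝ[X]} (hp : GammaCone d p)
    (h : p = 0 ∨ 0 < p.coeff 0) : GammaPositive p := by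
  rcases h with rfl | h
  · exact ⟨0, by simp, by simp⟩
  · have hd : p.natDegree = d := by
      refine le_antisymm hp.natDegree_le (le_natDegree_of_ne_zero ?_)
      rw [← hp.reflect_eq, coeff_reflect, revAt_le le_rfl, Nat.sub_self]
      exact h.ne'
    unfold GammaPositive
    rw [hd]
    exact hp.exists_coeff

end GammaCone

/-- A sum `a + X * b` of elements of consecutive gamma cones is its own symmetric decomposition. -/
theorem biGammaPositive_of_gammaCone {n : ℕ} {f a b : ℝ[X]} (hf : f.natDegree = n + 1)
    (hab : f = a + X * b) (ha : GammaCone (n + 1) a) (hb : GammaCone n b)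
    (ha₀ : a = 0 ∨ 0 < a.coeff 0) (hb₀ : b = 0 ∨ 0 < b.coeff 0) : BiGammaPositive f := by
  have hr : reflect (n + 1) f = a + b := by
    rw [hab, reflect_add, ha.reflect_eq, add_comm n 1,
      reflect_mul _ _ natDegree_X_le hb.natDegree_le, hb.reflect_eq]
    congr 1
    have : reflect 1 (X : ℝ[X]) = 1 := by simp
    rw [this, one_mul]
  refine ⟨a, b, ?_, ?_, ha.gammaPositive ha₀, hb.gammaPositive hb₀⟩
  · rw [hf, hr, hab]; ring
  · rw [hf, hr, hab]; ring

/-- Cross-multiplied ratio monotonicity of a sequence supported on `[0, n]`: the sequence is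
squeezed between its reversal and the shift of its reversal in the likelihood ratio order. -/
structure CrossRatioMonotone (n : ℤ) (f : ℤ → ℝ) : Prop where
  pos : ∀ k, 0 ≤ k → k ≤ n → 0 < f k
  eq_zero : ∀ k, k < 0 ∨ n < k → f k = 0
  reverse_le : ∀ k, f k * f (n - (k + 1)) ≤ f (k + 1) * f (n - k)
  le_shift : ∀ k, f (k + 1) * f (n - (k - 1)) ≤ f k * f (n - k)

namespace CrossRatioMonotone

variable {n : ℤ} {f : ℤ → ℝ}

theorem nonneg (h : CrossRatioMonotone n f) (k : ℤ) : 0 ≤ f k := by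
  by_cases hk : 0 ≤ k ∧ k ≤ n
  · exact (h.pos k hk.1 hk.2).le
  · exact (h.eq_zero k (by omega)).ge

theorem reverse_le_two (h : CrossRatioMonotone n f) (k : ℤ) :
    f (k - 1) * f (n - (k + 1)) ≤ f (k + 1) * f (n - (k - 1)) ∧
    f (k - 1) * f (n - (k + 1)) ≤ f k * f (n - k) := by
  by_cases hk : 1 ≤ k ∧ k + 1 ≤ n
  · have p₁ := h.pos (k - 1) (by omega) (by omega)
    have p₂ := h.pos k (by omega) (by omega)
    have p₃ := h.pos (k + 1) (by omega) (by omega)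
    have p₄ := h.pos (n - (k - 1)) (by omega) (by omega)
    have p₅ := h.pos (n - k) (by omega) (by omega)
    have p₆ := h.pos (n - (k + 1)) (by omega) (by omega)
    have r₁ := h.reverse_le (k - 1)
    rw [sub_add_cancel] at r₁
    have r₂ := h.reverse_le k
    have r₃ := h.le_shift k
    generalize f (k - 1) = a, f k = b, f (k + 1) = c, f (n - (k - 1)) = x, f (n - k) = y,
      f (n - (k + 1)) = z at *
    have h₁ : a * z ≤ c * x := by
      refine le_of_mul_le_mul_right ?_ (mul_pos p₂ p₅)
      have := mul_le_mul r₁ r₂ (by positivity) (by positivity)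
      linarith
    refine ⟨h₁, h₁.trans r₃⟩
  · have : f (k - 1) * f (n - (k + 1)) = 0 := by
      rcases not_and_or.1 hk with hk | hk
      · rw [h.eq_zero (k - 1) (by omega), zero_mul]
      · rw [h.eq_zero (n - (k + 1)) (by omega), mul_zero]
    rw [this]
    exact ⟨mul_nonneg (h.nonneg _) (h.nonneg _), mul_nonneg (h.nonneg _) (h.nonneg _)⟩

theorem le_shift_two (h : CrossRatioMonotone n f) (k : ℤ) :
    f (k + 1) * f (n - (k - 2)) ≤ f (k - 1) * f (n - k) ∧
    f (k + 1) * f (n - (k - 2)) ≤ f k * f (n - (k - 1)) := by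
  by_cases hk : 2 ≤ k ∧ k + 1 ≤ n
  · have p₁ := h.pos (k - 1) (by omega) (by omega)
    have p₂ := h.pos k (by omega) (by omega)
    have p₃ := h.pos (k + 1) (by omega) (by omega)
    have p₄ := h.pos (n - (k - 1)) (by omega) (by omega)
    have p₅ := h.pos (n - k) (by omega) (by omega)
    have p₆ := h.pos (n - (k - 2)) (by omega) (by omega)
    have r₁ := h.reverse_le (k - 1)
    have r₂ := h.le_shift (k - 1)
    rw [sub_add_cancel] at r₁ r₂
    rw [show k - 1 - 1 = k - 2 by ring] at r₂
    have r₃ := h.le_shift k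
    generalize f (k - 1) = a, f k = b, f (k + 1) = c, f (n - (k - 1)) = x, f (n - k) = y,
      f (n - (k - 2)) = z at *
    have h₁ : c * z ≤ a * y := by
      refine le_of_mul_le_mul_right ?_ (mul_pos p₂ p₄)
      have := mul_le_mul r₃ r₂ (by positivity) (by positivity)
      linarith
    exact ⟨h₁, h₁.trans r₁⟩
  · have : f (k + 1) * f (n - (k - 2)) = 0 := by
      rcases not_and_or.1 hk with hk | hk
      · rw [h.eq_zero (n - (k - 2)) (by omega), mul_zero]
      · rw [h.eq_zero (k + 1) (by omega), zero_mul]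
    rw [this]
    exact ⟨mul_nonneg (h.nonneg _) (h.nonneg _), mul_nonneg (h.nonneg _) (h.nonneg _)⟩

theorem succ (h : CrossRatioMonotone n f) (hn : 0 ≤ n) {q : ℝ} (hq : 1 ≤ q) {F : ℤ → ℝ}
    (hF : ∀ k : ℤ, F k = ((1 + q) * k + 1) * f k + ((1 + q) * (n + 1 - k) + q) * f (k - 1)) :
    CrossRatioMonotone (n + 1) F := by
  have hzero : ∀ k : ℤ, k < 0 ∨ n + 1 < k → F k = 0 := fun k hk => by
    rw [hF, h.eq_zero k (by omega), h.eq_zero (k - 1) (by omega)]; ring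
  have hpos : ∀ k : ℤ, 0 ≤ k → k ≤ n + 1 → 0 < F k := fun k h₀ h₁ => by
    rw [hF]
    have hk : (0 : ℝ) ≤ k := by exact_mod_cast h₀
    have hu : (0 : ℝ) ≤ n + 1 - k := by
      have : (k : ℝ) ≤ n + 1 := by exact_mod_cast h₁
      linarith
    have c₁ : 0 < (1 + q) * (k : ℝ) + 1 := by positivity
    have c₂ : 0 < (1 + q) * (n + 1 - k : ℝ) + q := by positivity
    rcases eq_or_lt_of_le h₁ with rfl | h₁
    · exact add_pos_of_nonneg_of_pos (mul_nonneg c₁.le (h.nonneg _))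
        (mul_pos c₂ (h.pos _ (by omega) (by omega)))
    · exact add_pos_of_pos_of_nonneg (mul_pos c₁ (h.pos _ (by omega) (by omega)))
        (mul_nonneg c₂.le (h.nonneg _))
  have hnonneg : ∀ k, 0 ≤ F k := fun k => by
    by_cases hk : 0 ≤ k ∧ k ≤ n + 1
    · exact (hpos k hk.1 hk.2).le
    · exact (hzero k (by omega)).ge
  have hG : ∀ k : ℤ, F (n + 1 - k) =
      ((1 + q) * k + q) * f (n - k) + ((1 + q) * (n + 1 - k) + 1) * f (n - (k - 1)) :=
    fun k => by
      rw [hF, show n + 1 - k - 1 = n - k by ring, show n + 1 - k = n - (k - 1) by ring]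
      push_cast; ring
  refine ⟨hpos, hzero, fun k => ?_, fun k => ?_⟩
  · by_cases hk : 0 ≤ k ∧ k ≤ n
    · have hk₀ : (0 : ℝ) ≤ k := by exact_mod_cast hk.1
      obtain ⟨u, hu⟩ : ∃ u : ℝ, (n : ℝ) = k + u - 1 := ⟨n + 1 - k, by ring⟩
      have hu₁ : 1 ≤ u := by
        have : (k : ℝ) ≤ n := by exact_mod_cast hk.2
        linarith
      rw [hG, hG, hF, hF]
      rw [show k + 1 - 1 = k by ring]
      have r₁ := h.reverse_le (k - 1)
      rw [sub_add_cancel] at r₁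
      have r₂ := h.reverse_le k
      obtain ⟨r₃, r₄⟩ := h.reverse_le_two k
      have hs := two_mul_le_add_of_sq_le_mul (r := f (k - 1) * f (n - (k + 1)))
        (mul_nonneg (h.nonneg (k + 1)) (h.nonneg (n - k)))
        (mul_nonneg (h.nonneg k) (h.nonneg (n - (k - 1)))) (by
          have := mul_le_mul r₃ r₄ (mul_nonneg (h.nonneg _) (h.nonneg _))
            (mul_nonneg (h.nonneg _) (h.nonneg _))
          linarith)
      push_cast
      rw [hu]
      generalize (k : ℝ) = t at *
      generalize f (k - 1) = a, f k = b, f (k + 1) = c, f (n - (k - 1)) = x, f (n - k) = y,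
        f (n - (k + 1)) = z at *
      have e₁ := mul_le_mul_of_nonneg_left r₂
        (show 0 ≤ ((1 + q) * t + 1) * ((1 + q) * t + (1 + q) + q) by positivity)
      have e₂ := mul_le_mul_of_nonneg_left r₃
        (show 0 ≤ ((1 + q) * t + (1 + q) + 1) * ((1 + q) * u + 1) by positivity)
      have e₃ := mul_le_mul_of_nonneg_left r₁
        (show 0 ≤ ((1 + q) * u + q) * ((1 + q) * u - q) from
          mul_nonneg (by positivity) (by nlinarith))
      have e₄ := mul_le_mul_of_nonneg_left r₄
        (show 0 ≤ (1 + q) * (q - 1) * (t + u) from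
          mul_nonneg (mul_nonneg (by linarith) (by linarith)) (by linarith))
      have e₅ := mul_le_mul_of_nonneg_left hs
        (show 0 ≤ (1 + q) * (q - 1) from mul_nonneg (by linarith) (by linarith))
      linarith
    · have : F k * F (n + 1 - (k + 1)) = 0 := by
        rcases not_and_or.1 hk with hk | hk
        · rw [hzero k (by omega), zero_mul]
        · rw [hzero (n + 1 - (k + 1)) (by omega), mul_zero]
      rw [this]
      exact mul_nonneg (hnonneg _) (hnonneg _)
  · by_cases hk : 1 ≤ k ∧ k ≤ n
    · have hk₁ : (1 : ℝ) ≤ k := by exact_mod_cast hk.1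
      obtain ⟨u, hu⟩ : ∃ u : ℝ, (n : ℝ) = k + u - 1 := ⟨n + 1 - k, by ring⟩
      have hu₁ : 1 ≤ u := by
        have : (k : ℝ) ≤ n := by exact_mod_cast hk.2
        linarith
      rw [hG, hG, hF, hF]
      rw [show k + 1 - 1 = k by ring, show k - 1 - 1 = k - 2 by ring]
      have r₁ := h.le_shift (k - 1)
      rw [sub_add_cancel, show k - 1 - 1 = k - 2 by ring] at r₁
      have r₂ := h.le_shift k
      obtain ⟨r₃, r₄⟩ := h.le_shift_two k
      have hs := two_mul_le_add_of_sq_le_mul (r := f (k + 1) * f (n - (k - 2)))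
        (mul_nonneg (h.nonneg k) (h.nonneg (n - k)))
        (mul_nonneg (h.nonneg (k - 1)) (h.nonneg (n - (k - 1)))) (by
          have := mul_le_mul r₃ r₄ (mul_nonneg (h.nonneg _) (h.nonneg _))
            (mul_nonneg (h.nonneg _) (h.nonneg _))
          linarith)
      push_cast
      rw [hu]
      generalize (k : ℝ) = t at *
      generalize f (k - 1) = a, f k = b, f (k + 1) = c, f (n - (k - 1)) = x, f (n - k) = y,
        f (n - (k - 2)) = z at *
      have e₁ := mul_le_mul_of_nonneg_left r₂
        (show 0 ≤ ((1 + q) * t + (1 + q) + 1) * ((1 + q) * t - 1) from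
          mul_nonneg (by positivity) (by nlinarith))
      have e₂ := mul_le_mul_of_nonneg_left r₃
        (show 0 ≤ ((1 + q) * t + q) * ((1 + q) * u + q) by positivity)
      have e₃ := mul_le_mul_of_nonneg_left r₁
        (show 0 ≤ ((1 + q) * u - 1) * ((1 + q) * u + (1 + q) + 1) from
          mul_nonneg (by nlinarith) (by positivity))
      have e₄ := mul_le_mul_of_nonneg_left r₄
        (show 0 ≤ 2 * (1 + q) * (t + u) by positivity)
      have e₅ := mul_le_mul_of_nonneg_left hs (show 0 ≤ 2 * (1 + q) by positivity)
      linarith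
    · have : F (k + 1) * F (n + 1 - (k - 1)) = 0 := by
        rcases not_and_or.1 hk with hk | hk
        · rw [hzero (n + 1 - (k - 1)) (by omega), mul_zero]
        · rw [hzero (k + 1) (by omega), zero_mul]
      rw [this]
      exact mul_nonneg (hnonneg _) (hnonneg _)

end CrossRatioMonotone

/-- The coefficients of a polynomial, extended by zero to negative indices. -/
noncomputable def intCoeff (p : ℝ[X]) (k : ℤ) : ℝ :=
  if 0 ≤ k then p.coeff k.toNat else 0

theorem intCoeff_natCast (p : ℝ[X]) (k : ℕ) : intCoeff p k = p.coeff k := by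
  simp [intCoeff]

theorem intCoeff_of_neg (p : ℝ[X]) {k : ℤ} (hk : k < 0) : intCoeff p k = 0 :=
  if_neg (not_le.2 hk)

theorem intCoeff_eulerian_step (q : ℝ) (n : ℕ) (p : ℝ[X]) (k : ℤ) :
    intCoeff ((C ((1 + q) * n + q) * X + 1) * p + C (1 + q) * X * (1 - X) * derivative p) k =
      ((1 + q) * k + 1) * intCoeff p k +
        ((1 + q) * ((n : ℤ) + 1 - k) + q) * intCoeff p (k - 1) := by
  have hp : (C ((1 + q) * n + q) * X + 1) * p + C (1 + q) * X * (1 - X) * derivative p =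
      p + X * (C ((1 + q) * n + q) * p + C (1 + q) * derivative p -
        C (1 + q) * (X * derivative p)) := by ring
  rw [hp]
  rcases lt_or_ge k 0 with hk | hk
  · simp [intCoeff_of_neg _ hk, intCoeff_of_neg _ (show k - 1 < 0 by omega)]
  · lift k to ℕ using hk
    cases k with
    | zero => simp [intCoeff]
    | succ k =>
      rw [show ((k + 1 : ℕ) : ℤ) - 1 = k by push_cast; ring]
      simp only [intCoeff_natCast, coeff_add, coeff_X_mul, coeff_sub, coeff_C_mul,
        coeff_derivative]
      cases k with
      | zero => simp; ring
      | succ k =>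
        simp only [coeff_X_mul, coeff_derivative]
        push_cast; ring

theorem ratioMonotone_reflect {n : ℕ} (hn : 1 ≤ n) {p : ℝ[X]}
    (h : CrossRatioMonotone n (intCoeff p)) : RatioMonotone (reflect n p) := by
  have hpos : ∀ k ≤ n, 0 < p.coeff k := fun k hk => by
    rw [← intCoeff_natCast]
    exact h.pos k (by omega) (by omega)
  have hzero : ∀ k, n < k → p.coeff k = 0 := fun k hk => by
    rw [← intCoeff_natCast]
    exact h.eq_zero k (by omega)
  have hcoeff : ∀ i ≤ n, (reflect n p).coeff i = p.coeff (n - i) := fun i hi => by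
    rw [coeff_reflect, revAt_le hi]
  have hdeg : (reflect n p).natDegree = n := by
    refine le_antisymm (natDegree_le_iff_coeff_eq_zero.2 fun k hk => ?_)
      (le_natDegree_of_ne_zero ?_)
    · rw [coeff_reflect, revAt_eq_self_of_lt hk, hzero k hk]
    · rw [hcoeff n le_rfl, Nat.sub_self]
      exact (hpos 0 (by omega)).ne'
  have hR : ∀ i j : ℕ, i + j + 1 = n →
      p.coeff i * p.coeff j ≤ p.coeff (i + 1) * p.coeff (j + 1) := fun i j hij => by
    simp only [← intCoeff_natCast]
    convert h.reverse_le i using 3 <;> omega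
  have hS : ∀ i j : ℕ, i + j = n →
      p.coeff (i + 1) * p.coeff (j + 1) ≤ p.coeff i * p.coeff j := fun i j hij => by
    simp only [← intCoeff_natCast]
    convert h.le_shift i using 3 <;> omega
  unfold RatioMonotone
  rw [hdeg]
  refine ⟨fun i hi => ?_, fun i hi => ?_, ?_, fun i hi => ?_, fun hm => ?_⟩
  · rw [hcoeff i hi]
    exact hpos _ (by omega)
  · rw [hcoeff _ (by omega), hcoeff _ (by omega), hcoeff _ (by omega), hcoeff _ (by omega),
      div_le_div_iff₀ (hpos _ (by omega)) (hpos _ (by omega))]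
    have := hR i (n - (i + 1)) (by omega)
    rwa [show n - (i + 1) + 1 = n - i by omega, show i + 1 = n - (n - (i + 1)) by omega,
      show p.coeff i = p.coeff (n - (n - i)) by congr 1; omega,
      show n - (n - (n - (i + 1))) = n - (i + 1) by omega] at this
  · rw [hcoeff _ (by omega), hcoeff _ (by omega), div_le_one (hpos _ (by omega))]
    obtain ⟨m, rfl | rfl⟩ : ∃ m, n = 2 * m + 1 ∨ n = 2 * m + 2 := ⟨(n - 1) / 2, by omega⟩
    · rw [show 2 * m + 1 - (2 * m + 1 - (2 * m + 1 - 1) / 2) = m by omega,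
        show 2 * m + 1 - (2 * m + 1 - 1) / 2 = m + 1 by omega]
      exact (mul_self_le_mul_self_iff (hpos _ (by omega)).le (hpos _ (by omega)).le).2
        (hR m m (by omega))
    · rw [show 2 * m + 2 - (2 * m + 2 - (2 * m + 2 - 1) / 2) = m by omega,
        show 2 * m + 2 - (2 * m + 2 - 1) / 2 = m + 1 + 1 by omega]
      refine le_of_mul_le_mul_right ?_ (hpos (m + 1) (by omega))
      linarith [hR m (m + 1) (by omega)]
  · rw [hcoeff _ (by omega), hcoeff _ (by omega), hcoeff _ (by omega), hcoeff _ (by omega),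
      div_le_div_iff₀ (hpos _ (by omega)) (hpos _ (by omega))]
    have := hS (i + 1) (n - (i + 1)) (by omega)
    rw [show n - (i + 1) + 1 = n - i by omega] at this
    rw [show n - (n - 1 - (i + 1)) = i + 1 + 1 by omega,
      show n - (n - 1 - i) = i + 1 by omega]
    linarith
  · rw [hcoeff _ (by omega), hcoeff _ (by omega), div_le_one (hpos _ (by omega))]
    obtain ⟨m, rfl | rfl⟩ : ∃ m, n = 2 * m ∨ n = 2 * m + 1 := ⟨n / 2, by omega⟩
    · rw [show 2 * m - (2 * m / 2 - 1) = m + 1 by omega,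
        show 2 * m - (2 * m - 2 * m / 2) = m by omega]
      exact (mul_self_le_mul_self_iff (hpos _ (by omega)).le (hpos _ (by omega)).le).2
        (hS m m (by omega))
    · rw [show 2 * m + 1 - ((2 * m + 1) / 2 - 1) = m + 1 + 1 by omega,
        show 2 * m + 1 - (2 * m + 1 - (2 * m + 1) / 2) = m by omega]
      refine le_of_mul_le_mul_right ?_ (hpos (m + 1) (by omega))
      linarith [hS m (m + 1) (by omega)]

theorem eulerianB_gammaCone_decomposition (q : ℝ) (hq : 1 ≤ q) (B : ℕ → ℝ[X]) (hB0 : B 0 = 1)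
    (hrec : ∀ n : ℕ, B (n + 1) = (C ((1 + q) * n + q) * X + 1) * B n +
      C (1 + q) * X * (1 - X) * derivative (B n)) (n : ℕ) :
    ∃ a b : ℝ[X], B (n + 1) = a + X * b ∧ GammaCone (n + 1) a ∧ GammaCone n b ∧
      a.coeff 0 = 1 ∧ (b = 0 ∨ 0 < b.coeff 0) := by
  have hq₁ : 0 ≤ q - 1 := by linarith
  induction n with
  | zero =>
    refine ⟨1 + X, C (q - 1), ?_, ?_, ?_, by simp, ?_⟩
    · simp only [hrec, hB0, Nat.cast_zero, derivative_one, map_sub, map_add, map_mul, map_zero,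
        map_one]
      ring
    · simpa using GammaCone.basis (d := 0 + 1) 0 1 1 rfl zero_le_one
    · simpa using GammaCone.basis (d := 0) 0 0 (q - 1) rfl hq₁
    · rcases eq_or_lt_of_le hq₁ with h | h
      · left; rw [← h, map_zero]
      · right; simpa using h
  | succ n ih =>
    obtain ⟨a, b, hab, ha, hb, ha₀, hb₀⟩ := ih
    refine ⟨C (1 + q) * (C ((n + 1 : ℕ) : ℝ) * X * a + X * (1 - X) * derivative a) +
        (1 + X) * a + C 2 * (X * b),
      C (1 + q) * (C (n : ℝ) * X * b + X * (1 - X) * derivative b) + C (q - 1) * a +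
        C q * ((1 + X) * b), ?_, ?_, ?_, ?_, ?_⟩
    · rw [hrec, hab]
      simp only [derivative_mul, derivative_X, Nat.cast_add, Nat.cast_one,
        map_add, map_mul, map_sub, map_one, map_ofNat]
      ring
    · exact ((ha.eulerian_operator.C_mul (by linarith)).add ha.one_add_X_mul).add
        (hb.X_mul.C_mul (by norm_num))
    · exact ((hb.eulerian_operator.C_mul (by linarith)).add (ha.C_mul hq₁)).add
        (hb.one_add_X_mul.C_mul (by linarith))
    · simp [mul_coeff_zero, ha₀]
    · rcases eq_or_lt_of_le hq₁ with h | h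
      · rcases hb₀ with rfl | hb₀
        · left; simp [← h]
        · right
          simpa [mul_coeff_zero, ← h] using mul_pos (show 0 < q by linarith) hb₀
      · right
        have : 0 ≤ b.coeff 0 := by
          rcases hb₀ with rfl | hb₀
          · simp
          · exact hb₀.le
        have : 0 < q - 1 + q * b.coeff 0 := by positivity
        simpa [mul_coeff_zero, ha₀] using this

theorem eulerianB_crossRatioMonotone (q : ℝ) (hq : 1 ≤ q) (B : ℕ → ℝ[X]) (hB0 : B 0 = 1)
    (hrec : ∀ n : ℕ, B (n + 1) = (C ((1 + q) * n + q) * X + 1) * B n +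
      C (1 + q) * X * (1 - X) * derivative (B n)) (n : ℕ) :
    CrossRatioMonotone n (intCoeff (B n)) := by
  induction n with
  | zero =>
    have h : ∀ k : ℤ, intCoeff (B 0) k = if k = 0 then 1 else 0 := fun k => by
      rcases lt_or_ge k 0 with hk | hk
      · rw [intCoeff_of_neg _ hk, if_neg hk.ne]
      · lift k to ℕ using hk
        simp [intCoeff_natCast, hB0, coeff_one]
    refine ⟨fun k h₀ h₁ => ?_, fun k hk => ?_, fun k => ?_, fun k => ?_⟩
    · rw [h, if_pos (by simp at h₁; omega)]; exact one_pos
    · rw [h, if_neg (by simp at hk; omega)]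
    · simp only [h]
      split_ifs <;> first | omega | simp
    · simp only [h]
      split_ifs <;> first | omega | simp
  | succ n ih =>
    rw [Nat.cast_succ]
    exact ih.succ (by positivity) hq fun k => by rw [hrec, intCoeff_eulerian_step]

/-- for `q ≥ 1`, the type `B` `q`-Eulerian polynomials `B n` are
bi-gamma-positive and their reciprocals `X^n * (B n)(1/X)` are ratio monotone
for `n ≥ 1`. -/
theorem stmt17 (q : ℝ) (hq : 1 ≤ q)
    (B : ℕ → Polynomial ℝ) (hB0 : B 0 = 1)
    (hrec : ∀ n : ℕ, B (n + 1) =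
      (Polynomial.C ((1 + q) * n + q) * Polynomial.X + 1) * B n +
        Polynomial.C (1 + q) * Polynomial.X * (1 - Polynomial.X) *
          Polynomial.derivative (B n))
    (hdeg : ∀ n : ℕ, (B n).natDegree = n) :
    ∀ n : ℕ, 1 ≤ n → BiGammaPositive (B n) ∧
      RatioMonotone (Polynomial.reflect n (B n)) := by
  intro n hn
  refine ⟨?_, ratioMonotone_reflect hn (eulerianB_crossRatioMonotone q hq B hB0 hrec n)⟩
  obtain ⟨m, rfl⟩ : ∃ m, n = m + 1 := ⟨n - 1, by omega⟩
  obtain ⟨a, b, hab, ha, hb, ha₀, hb₀⟩ := eulerianB_gammaCone_decomposition q hq B hB0 hrec m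
  exact biGammaPositive_of_gammaCone (hdeg _) hab ha hb (Or.inr (by rw [ha₀]; exact one_pos)) hb₀
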